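/- There exists a constant c > 0 with the following property. Let f : ℝ → ℝ be a continuous nondecreasing function such that f(t) = 0 for all t ≤ 0, the restriction of f to [0, ∞) is concave, and f(t)/t → 0 as t → +∞. Then for every δ > 0 and all bounded self-adjoint operators A, B on a complex Hilbert space with ‖A − B‖ ≤ δ, one has ‖f(A) − f(B)‖ ≤ c · ∫_e^∞ f(δ·s)/(s² · log s) ds, the inequality being understood in [0, ∞] (it is nontrivial whenever the integral on the right-hand side is finite). -/

import Mathlib

open MeasureTheory ENNReal

/-- `|T| = (T*T)^{1/2}` via the continuous functional calculus. -/
noncomputable def opAbs {H : Type} [NormedAddCommGroup H] [InnerProductSpace ℂ H]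
    [CompleteSpace H] (T : H →L[ℂ] H) : H →L[ℂ] H :=
  cfc Real.sqrt (star T * T)

/-- The Hilbert space `ℓ²(ℕ, ℂ)`. -/
noncomputable abbrev ellTwo : Type := lp (fun _ : ℕ => ℂ) 2

/-- The Euclidean norm of a finite family of complex numbers. -/
noncomputable def l2Norm {n : ℕ} (ξ : Fin n → ℂ) : ℝ := √(∑ i, ‖ξ i‖ ^ 2)

/-- The matrix `X` has operator norm at most `L`, expressed through its bilinear form. -/
def IsBilinBound {p q : ℕ} (X : Fin p → Fin q → ℂ) (L : ℝ) : Prop :=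
  ∀ (ξ : Fin p → ℂ) (η : Fin q → ℂ),
    ‖∑ i, ∑ j, ξ i * X i j * η j‖ ≤ L * (l2Norm ξ * l2Norm η)

/-- The kernel `m` is a Schur multiplier of norm at most `K`, uniformly over finite matrices. -/
def IsSchurBound (m : ℝ → ℝ → ℝ) (K : ℝ) : Prop :=
  ∀ (p q : ℕ) (x : Fin p → ℝ) (y : Fin q → ℝ) (X : Fin p → Fin q → ℂ) (L : ℝ), 0 ≤ L →
    IsBilinBound X L → IsBilinBound (fun i j => (m (x i) (y j) : ℂ) * X i j) (K * L)

lemma l2Norm_nonneg {n : ℕ} (ξ : Fin n → ℂ) : 0 ≤ l2Norm ξ := Real.sqrt_nonneg _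

lemma l2Norm_mul_le {n : ℕ} (ξ : Fin n → ℂ) (α : Fin n → ℝ) {a : ℝ} (ha : 0 ≤ a)
    (h : ∀ i, |α i| ≤ a) : l2Norm (fun i => (α i : ℂ) * ξ i) ≤ a * l2Norm ξ := by
  unfold l2Norm
  rw [← Real.sqrt_sq ha, ← Real.sqrt_mul (sq_nonneg a)]
  apply Real.sqrt_le_sqrt
  rw [Finset.mul_sum]
  apply Finset.sum_le_sum
  intro i _
  rw [norm_mul, mul_pow, Complex.norm_real, Real.norm_eq_abs]
  gcongr
  exact h i

lemma l2Norm_sq_split {n : ℕ} (ξ : Fin n → ℂ) (s : Fin n → Prop) [DecidablePred s] :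
    l2Norm (fun i => if s i then ξ i else 0) ^ 2 + l2Norm (fun i => if s i then 0 else ξ i) ^ 2
      = l2Norm ξ ^ 2 := by
  unfold l2Norm
  rw [Real.sq_sqrt (by positivity), Real.sq_sqrt (by positivity), Real.sq_sqrt (by positivity),
    ← Finset.sum_add_distrib]
  apply Finset.sum_congr rfl
  intro i _
  by_cases h : s i <;> simp [h]

namespace IsSchurBound

variable {m m₁ m₂ : ℝ → ℝ → ℝ} {K K₁ K₂ : ℝ}

lemma mono (h : IsSchurBound m K₁) (hK : K₁ ≤ K₂) : IsSchurBound m K₂ := by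
  intro p q x y X L hL hX ξ η
  refine (h p q x y X L hL hX ξ η).trans ?_
  have := l2Norm_nonneg ξ
  have := l2Norm_nonneg η
  gcongr

lemma congr (h : IsSchurBound m₁ K) (e : ∀ x y, m₁ x y = m₂ x y) : IsSchurBound m₂ K := by
  rwa [← show m₁ = m₂ from funext₂ e]

lemma zero : IsSchurBound (fun _ _ => 0) 0 := by
  intro p q x y X L hL hX ξ η
  simp

lemma one : IsSchurBound (fun _ _ => 1) 1 := by
  intro p q x y X L hL hX ξ η
  simpa using hX ξ η

lemma add (h₁ : IsSchurBound m₁ K₁) (h₂ : IsSchurBound m₂ K₂) :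
    IsSchurBound (fun x y => m₁ x y + m₂ x y) (K₁ + K₂) := by
  intro p q x y X L hL hX ξ η
  have e : ∑ i, ∑ j, ξ i * (((m₁ (x i) (y j) + m₂ (x i) (y j) : ℝ) : ℂ) * X i j) * η j
      = (∑ i, ∑ j, ξ i * ((m₁ (x i) (y j) : ℂ) * X i j) * η j)
        + ∑ i, ∑ j, ξ i * ((m₂ (x i) (y j) : ℂ) * X i j) * η j := by
    simp only [← Finset.sum_add_distrib]
    refine Finset.sum_congr rfl fun i _ => Finset.sum_congr rfl fun j _ => ?_
    push_cast
    ring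
  simp only [e]
  refine (norm_add_le _ _).trans ?_
  have a := h₁ p q x y X L hL hX ξ η
  have b := h₂ p q x y X L hL hX ξ η
  simp only at a b
  linarith

lemma mul (h : IsSchurBound m K) (hK : 0 ≤ K) {α β : ℝ → ℝ} {a b : ℝ} (ha : 0 ≤ a) (hb : 0 ≤ b)
    (hα : ∀ x, |α x| ≤ a) (hβ : ∀ y, |β y| ≤ b) :
    IsSchurBound (fun x y => α x * β y * m x y) (a * b * K) := by
  intro p q x y X L hL hX ξ η
  have e := h p q x y X L hL hX (fun i => (α (x i) : ℂ) * ξ i) (fun j => (β (y j) : ℂ) * η j)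
  have e' : ∑ i, ∑ j, ξ i * (((α (x i) * β (y j) * m (x i) (y j) : ℝ) : ℂ) * X i j) * η j
      = ∑ i, ∑ j, ((α (x i) : ℂ) * ξ i) * ((m (x i) (y j) : ℂ) * X i j) * ((β (y j) : ℂ) * η j) := by
    refine Finset.sum_congr rfl fun i _ => Finset.sum_congr rfl fun j _ => ?_
    push_cast
    ring
  simp only [e']
  refine e.trans ?_
  have h1 := l2Norm_mul_le ξ (fun i => α (x i)) ha fun i => hα _
  have h2 := l2Norm_mul_le η (fun j => β (y j)) hb fun i => hβ _
  have := mul_le_mul h1 h2 (l2Norm_nonneg _) (mul_nonneg ha (l2Norm_nonneg _))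
  calc _ ≤ K * L * (a * l2Norm ξ * (b * l2Norm η)) := by gcongr
    _ = _ := by ring

lemma rankOne {α β : ℝ → ℝ} {a b : ℝ} (ha : 0 ≤ a) (hb : 0 ≤ b)
    (hα : ∀ x, |α x| ≤ a) (hβ : ∀ y, |β y| ≤ b) :
    IsSchurBound (fun x y => α x * β y) (a * b) := by
  simpa using one.mul zero_le_one ha hb hα hβ

lemma neg (h : IsSchurBound m K) : IsSchurBound (fun x y => - m x y) K := by
  intro p q x y X L hL hX ξ η
  simpa using h p q x y X L hL hX ξ η

lemma swap (h : IsSchurBound m K) : IsSchurBound (fun x y => m y x) K := by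
  intro p q x y X L hL hX ξ η
  have e := h q p y x (fun j i => X i j) L hL (fun η ξ => by
    rw [Finset.sum_comm, mul_comm (l2Norm η)]
    simpa only [mul_comm, mul_left_comm] using hX ξ η) η ξ
  rw [Finset.sum_comm, mul_comm (l2Norm η)] at e
  simpa only [mul_comm, mul_left_comm] using e

lemma comp (h : IsSchurBound m K) (φ ψ : ℝ → ℝ) : IsSchurBound (fun x y => m (φ x) (ψ y)) K := by
  intro p q x y X L hL hX
  exact h p q (φ ∘ x) (ψ ∘ y) X L hL hX

open Classical in
/-- Block diagonal kernels. -/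
lemma block (h₁ : IsSchurBound m₁ K) (h₂ : IsSchurBound m₂ K) (hK : 0 ≤ K) (s t : Set ℝ) :
    IsSchurBound (fun x y => if x ∈ s ∧ y ∈ t then m₁ x y else
      if x ∉ s ∧ y ∉ t then m₂ x y else 0) K := by
  intro p q x y X L hL hX ξ η
  set ξ₁ : Fin p → ℂ := fun i => if x i ∈ s then ξ i else 0 with hξ₁
  set ξ₂ : Fin p → ℂ := fun i => if x i ∈ s then 0 else ξ i with hξ₂
  set η₁ : Fin q → ℂ := fun i => if y i ∈ t then η i else 0 with hη₁
  set η₂ : Fin q → ℂ := fun i => if y i ∈ t then 0 else η i with hη₂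
  have e₁ := h₁ p q x y X L hL hX ξ₁ η₁
  have e₂ := h₂ p q x y X L hL hX ξ₂ η₂
  have e : ∑ i, ∑ j, ξ i * (((if x i ∈ s ∧ y j ∈ t then m₁ (x i) (y j) else
      if x i ∉ s ∧ y j ∉ t then m₂ (x i) (y j) else 0 : ℝ) : ℂ) * X i j) * η j
      = (∑ i, ∑ j, ξ₁ i * ((m₁ (x i) (y j) : ℂ) * X i j) * η₁ j)
        + ∑ i, ∑ j, ξ₂ i * ((m₂ (x i) (y j) : ℂ) * X i j) * η₂ j := by
    simp only [← Finset.sum_add_distrib]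
    refine Finset.sum_congr rfl fun i _ => Finset.sum_congr rfl fun j _ => ?_
    by_cases hs : x i ∈ s <;> by_cases ht : y j ∈ t <;> simp [hξ₁, hξ₂, hη₁, hη₂, hs, ht]
  simp only [e]
  refine (norm_add_le _ _).trans ((add_le_add e₁ e₂).trans ?_)
  rw [← mul_add]
  refine mul_le_mul_of_nonneg_left ?_ (mul_nonneg hK hL)
  have hξ := l2Norm_sq_split ξ (fun i => x i ∈ s)
  have hη := l2Norm_sq_split η (fun i => y i ∈ t)
  refine abs_le_of_sq_le_sq' ?_ (mul_nonneg (l2Norm_nonneg ξ) (l2Norm_nonneg η)) |>.2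
  rw [mul_pow, ← hξ, ← hη]
  change _ ≤ (l2Norm ξ₁ ^ 2 + l2Norm ξ₂ ^ 2) * (l2Norm η₁ ^ 2 + l2Norm η₂ ^ 2)
  nlinarith [sq_nonneg (l2Norm ξ₁ * l2Norm η₂ - l2Norm ξ₂ * l2Norm η₁)]

open Classical in
/-- The Cauchy kernel on a pair of separated half-lines, through
`1 / (y - x) = ∫ t > 0, exp (-t * (y - x))`. -/
lemma cauchy {p q : ℝ} (hpq : p < q) :
    IsSchurBound (fun x y => if x ≤ p ∧ q ≤ y then (q - p) / (y - x) else 0) 1 := by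
  intro n k x y X L hL hX ξ η
  set α : ℝ → ℝ → ℝ := fun t x => if x ≤ p then Real.exp (t * (x - p)) else 0 with hα
  set β : ℝ → ℝ → ℝ := fun t y => if q ≤ y then (q - p) * Real.exp (-(t * (y - p))) else 0 with hβ
  have key : ∀ x y, IntegrableOn (fun t => α t x * β t y) (Set.Ioi 0) ∧
      ∫ t in Set.Ioi (0 : ℝ), α t x * β t y =
        if x ≤ p ∧ q ≤ y then (q - p) / (y - x) else 0 := by
    intro x y
    by_cases hx : x ≤ p
    · by_cases hy : q ≤ y
      · have hyx : x - y < 0 := by linarith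
        have e : ∀ t, α t x * β t y = (q - p) * Real.exp ((x - y) * t) := by
          intro t
          simp only [hα, hβ, hx, hy, if_true]
          rw [mul_left_comm, ← Real.exp_add]
          ring_nf
        simp only [e, hx, hy, and_self, if_true]
        constructor
        · exact (integrableOn_exp_mul_Ioi hyx 0).const_mul _
        · rw [integral_const_mul, integral_exp_mul_Ioi hyx]
          simp only [mul_zero, Real.exp_zero]
          rw [← neg_sub y x, neg_div_neg_eq]
          ring
      · simp [hβ, hy]
    · simp [hα, hx]
  have e : ∑ i, ∑ j, ξ i * (((if x i ≤ p ∧ q ≤ y j then (q - p) / (y j - x i) else 0 : ℝ) : ℂ)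
        * X i j) * η j
      = ∫ t in Set.Ioi (0 : ℝ), ∑ i, ∑ j,
          ((α t (x i) : ℂ) * ξ i) * X i j * ((β t (y j) : ℂ) * η j) := by
    have hi : ∀ i j, IntegrableOn (fun t => ((α t (x i) : ℂ) * ξ i) * X i j * ((β t (y j) : ℂ) * η j))
        (Set.Ioi 0) := by
      intro i j
      have := ((key (x i) (y j)).1.ofReal (𝕜 := ℂ)).const_mul (ξ i * X i j * η j)
      refine this.congr (Filter.Eventually.of_forall fun t => ?_)
      simp only [Complex.coe_algebraMap, RCLike.ofReal_mul]
      ring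
    rw [integral_finsetSum _ fun i _ => integrable_finsetSum _ fun j _ => hi i j]
    refine Finset.sum_congr rfl fun i _ => ?_
    rw [integral_finsetSum _ fun j _ => hi i j]
    refine Finset.sum_congr rfl fun j _ => ?_
    rw [← (key (x i) (y j)).2, ← integral_complex_ofReal, mul_comm _ (X i j), ← mul_assoc,
      mul_assoc _ _ (η j), mul_comm _ (η j), ← mul_assoc, ← integral_const_mul]
    refine integral_congr_ae (Filter.Eventually.of_forall fun t => ?_)
    simp only
    push_cast
    ring
  simp only [e]
  have hqp : p - q < 0 := by linarith
  refine (norm_integral_le_of_norm_le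
    (g := fun t => (L * (l2Norm ξ * l2Norm η) * (q - p)) * Real.exp ((p - q) * t))
    ((integrableOn_exp_mul_Ioi hqp 0).const_mul _) ?_).trans ?_
  · refine (ae_restrict_iff' measurableSet_Ioi).2 (Filter.Eventually.of_forall fun t ht => ?_)
    have ht0 : (0 : ℝ) < t := ht
    refine (hX _ _).trans ?_
    have h1 := l2Norm_mul_le ξ (fun i => α t (x i)) zero_le_one fun i => by
      simp only [hα]
      split_ifs with h
      · rw [abs_of_pos (Real.exp_pos _), Real.exp_le_one_iff]
        nlinarith
      · simp
    have h2 := l2Norm_mul_le η (fun i => β t (y i)) (a := (q - p) * Real.exp ((p - q) * t))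
      (by have := Real.exp_pos ((p - q) * t); nlinarith) fun i => by
      simp only [hβ]
      have h0 : 0 ≤ q - p := by linarith
      split_ifs with h
      · rw [abs_of_nonneg (by positivity)]
        refine mul_le_mul_of_nonneg_left (Real.exp_le_exp.2 ?_) h0
        nlinarith
      · simp only [abs_zero]
        positivity
    have := mul_le_mul h1 h2 (l2Norm_nonneg _) (mul_nonneg zero_le_one (l2Norm_nonneg _))
    calc _ ≤ L * (1 * l2Norm ξ * ((q - p) * Real.exp ((p - q) * t) * l2Norm η)) := by gcongr
      _ = _ := by ring
  · rw [integral_const_mul, integral_exp_mul_Ioi hqp]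
    simp only [mul_zero, Real.exp_zero]
    rw [mul_assoc, ← neg_sub q p, neg_div_neg_eq, mul_one_div_cancel (by linarith)]
    simp

end IsSchurBound

open Classical in
/-- A truncated triangular projection: its Schur norm is linear in `k` while the truncation range
is doubly exponential in `k`. -/
lemma IsSchurBound.triangular (k : ℕ) : ∀ a : ℝ, 0 < a →
    IsSchurBound (fun x y => if x ≤ 0 ∧ a ≤ y ∧ y ≤ a * 2 ^ 2 ^ k then y / (y - x) else 0)
      (2 + 3 * k) := by
  induction k with
  | zero =>
    intro a ha
    have h := (IsSchurBound.cauchy ha).mul zero_le_one zero_le_one zero_le_two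
      (α := fun _ => 1) (β := fun y => if a ≤ y ∧ y ≤ a * 2 then y / a else 0) (by simp)
      (by
        intro y
        split_ifs with h
        · rw [abs_of_nonneg (by have := h.1; have : 0 ≤ y := by linarith
                                positivity), div_le_iff₀ ha]
          linarith [h.2]
        · simp)
    refine (h.mono (by norm_num)).congr fun x y => ?_
    simp only [pow_zero, pow_one, sub_zero, one_mul]
    by_cases hx : x ≤ 0 <;> by_cases h1 : a ≤ y <;> by_cases h2 : y ≤ a * 2 <;>
      simp only [hx, h1, h2, and_true, and_false, if_true, if_false, mul_zero,
        zero_mul]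
    field_simp
  | succ k ih =>
    intro a ha
    set b : ℝ := a * 2 ^ 2 ^ k with hb
    have hb2 : a * 2 ^ 2 ^ (k + 1) = b * 2 ^ 2 ^ k := by
      rw [hb, pow_succ 2 k, pow_mul, sq]
      ring
    have h1k : (1 : ℝ) ≤ 2 ^ 2 ^ k := one_le_pow₀ one_le_two
    have hab : a ≤ b := by nlinarith
    have hb0 : 0 < b := by linarith
    have hbb : b ≤ b * 2 ^ 2 ^ k := by nlinarith
    rw [hb2]
    set d : ℝ := b * 2 ^ 2 ^ k
    have hK : (0 : ℝ) ≤ 2 + 3 * k := by positivity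
    have hdiag := (ih a ha).block (ih b hb0) hK {x | -b ≤ x} {y | y ≤ b}
    have hlow := (IsSchurBound.cauchy (neg_lt_zero.2 hb0)).mul zero_le_one zero_le_one zero_le_one
      (α := fun x => if x < -b then 1 else 0)
      (β := fun y => if a ≤ y ∧ y ≤ b then y / b else 0)
      (by intro x; split_ifs <;> simp)
      (by
        intro y
        split_ifs with h
        · rw [abs_of_nonneg (by have := h.1; have : 0 ≤ y := by linarith
                                positivity), div_le_iff₀ hb0]
          linarith [h.2]
        · simp)
    have hhigh₁ := IsSchurBound.rankOne zero_le_one zero_le_one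
      (α := fun x => if -b ≤ x ∧ x ≤ 0 then 1 else 0)
      (β := fun y => if b < y ∧ y ≤ d then 1 else 0)
      (by intro x; split_ifs <;> simp) (by intro x; split_ifs <;> simp)
    have hhigh₂ := (IsSchurBound.cauchy hb0).mul zero_le_one zero_le_one zero_le_one
      (α := fun x => if -b ≤ x ∧ x ≤ 0 then x / b else 0)
      (β := fun y => if b < y ∧ y ≤ d then 1 else 0)
      (by
        intro x
        split_ifs with h
        · rw [abs_div, abs_of_pos hb0, div_le_iff₀ hb0, one_mul, abs_le]
          constructor <;> linarith [h.1, h.2]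
        · simp)
      (by intro x; split_ifs <;> simp)
    refine (((hdiag.add hlow).add (hhigh₁.add hhigh₂)).mono (by push_cast; linarith)).congr
      fun x y => ?_
    simp only [Set.mem_ofPred_eq, sub_zero, zero_sub, neg_neg]
    rcases lt_or_ge x (-b) with hx | hx
    · have hx0 : x ≤ 0 := by linarith
      have hx1 : ¬ -b ≤ x := not_le.2 hx
      have hx2 : x ≤ -b := hx.le
      rcases le_or_gt y b with hy | hy
      · have hyd : y ≤ d := by linarith
        have hyb : ¬ b < y := not_lt.2 hy
        by_cases hya : a ≤ y
        · have hy0 : 0 ≤ y := by linarith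
          simp [hx, hx0, hx1, hx2, hy, hyd, hyb, hya, hy0]
          field_simp
        · simp [hx, hx0, hx1, hx2, hy, hyd, hyb, hya]
      · have hya : a ≤ y := by linarith
        have hyb : ¬ y ≤ b := not_le.2 hy
        simp [hx, hx0, hx1, hx2, hy.le, hyb, hya, hy]
        rfl
    · have hx1 : ¬ x < -b := not_lt.2 hx
      rcases le_or_gt y b with hy | hy
      · have hyd : y ≤ d := by linarith
        have hyb : ¬ b < y := not_lt.2 hy
        simp [hx, hx1, hy, hyd, hyb]
        simp only [← hb, hy, and_true]
      · have hya : a ≤ y := by linarith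
        have hyb : ¬ y ≤ b := not_le.2 hy
        by_cases hx0 : x ≤ 0
        · by_cases hyd : y ≤ d
          · have hyx : y - x ≠ 0 := by linarith
            simp [hx, hx0, hx1, hy.le, hyd, hyb, hya, hy]
            field_simp
            ring
          · simp [hx, hx0, hx1, hy.le, hyd, hyb, hya, hy]
        · simp [hx, hx0, hx1, hy.le, hyb, hya, hy]

/-- The function `g` splits as a multiple of `x - y` by a Schur multiplier of norm `K₁`, plus a
Schur multiplier of norm `K₂`. -/
def IsDiffBound (g : ℝ → ℝ → ℝ) (K₁ K₂ : ℝ) : Prop :=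
  ∃ M E : ℝ → ℝ → ℝ, IsSchurBound M K₁ ∧ IsSchurBound E K₂ ∧
    ∀ x y, g x y = M x y * (x - y) + E x y

namespace IsDiffBound

variable {g g' : ℝ → ℝ → ℝ} {K₁ K₂ K₁' K₂' : ℝ}

lemma add (h : IsDiffBound g K₁ K₂) (h' : IsDiffBound g' K₁' K₂') :
    IsDiffBound (fun x y => g x y + g' x y) (K₁ + K₁') (K₂ + K₂') := by
  obtain ⟨M, E, hM, hE, e⟩ := h
  obtain ⟨M', E', hM', hE', e'⟩ := h'
  refine ⟨_, _, hM.add hM', hE.add hE', fun x y => ?_⟩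
  simp only [e, e']
  ring

lemma neg (h : IsDiffBound g K₁ K₂) : IsDiffBound (fun x y => - g x y) K₁ K₂ := by
  obtain ⟨M, E, hM, hE, e⟩ := h
  refine ⟨_, _, hM.neg, hE.neg, fun x y => ?_⟩
  simp only [e]
  ring

lemma swap (h : IsDiffBound g K₁ K₂) : IsDiffBound (fun x y => g y x) K₁ K₂ := by
  obtain ⟨M, E, hM, hE, e⟩ := h
  refine ⟨_, _, hM.swap.neg, hE.swap, fun x y => ?_⟩
  simp only [e]
  ring

lemma reflect (h : IsDiffBound g K₁ K₂) (r : ℝ) :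
    IsDiffBound (fun x y => g (r - x) (r - y)) K₁ K₂ := by
  obtain ⟨M, E, hM, hE, e⟩ := h
  refine ⟨_, _, (hM.comp (fun x => r - x) (fun y => r - y)).neg,
    hE.comp (fun x => r - x) (fun y => r - y), fun x y => ?_⟩
  simp only [e]
  ring

open Classical in
lemma kink {δ r : ℝ} (hδ : 0 < δ) {k : ℕ} (hr : r ≤ δ * 2 ^ 2 ^ k) :
    IsDiffBound (fun x y => if x < 0 ∧ 0 ≤ y ∧ y ≤ r then y else 0) (2 + 3 * k) δ := by
  have hM := ((IsSchurBound.triangular k δ hδ).mul (by positivity) zero_le_one zero_le_one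
      (α := fun x => if x < 0 then 1 else 0) (β := fun y => if y ≤ r then 1 else 0)
      (by intro x; split_ifs <;> simp) (by intro x; split_ifs <;> simp)).neg
  have hE := IsSchurBound.rankOne zero_le_one hδ.le
    (α := fun x => if x < 0 then 1 else 0)
    (β := fun y => if 0 ≤ y ∧ y ≤ r ∧ y < δ then y else 0)
    (by intro x; split_ifs <;> simp) (by
      intro y
      split_ifs with h
      · rw [abs_of_nonneg h.1]
        exact h.2.2.le
      · simpa using hδ.le)
  refine ⟨_, _, hM.mono (by linarith), hE.mono (by linarith), fun x y => ?_⟩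
  by_cases hx : x < 0
  · by_cases hy : y ≤ r
    · by_cases hy0 : 0 ≤ y
      · rcases lt_or_ge y δ with hyd | hyd
        · simp [hx, hy, hy0, hyd, not_le.2 hyd]
        · have : y - x ≠ 0 := by linarith
          simp [hx, hx.le, hy, hy0, hyd, not_lt.2 hyd, hy.trans hr]
          field_simp
          ring
      · have : ¬ δ ≤ y := by intro h; exact hy0 (hδ.le.trans h)
        simp [hx, hy, hy0, this]
    · simp [hy]
  · simp [hx]

open Classical in
lemma truncation {δ r : ℝ} (hδ : 0 < δ) (hr0 : 0 < r) {k : ℕ} (hr : r ≤ δ * 2 ^ 2 ^ k) :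
    IsDiffBound (fun x y => min (max x 0) r - min (max y 0) r) (11 + 12 * k) (4 * δ) := by
  have h12 := kink hδ hr
  have h13 : IsDiffBound (fun x y => if x < 0 ∧ r < y then r else 0) 1 0 := by
    have hM := ((IsSchurBound.cauchy hr0).mul zero_le_one zero_le_one zero_le_one
      (α := fun x => if x < 0 then 1 else 0) (β := fun y => if r < y then 1 else 0)
      (by intro x; split_ifs <;> simp) (by intro x; split_ifs <;> simp)).neg
    refine ⟨_, _, hM.mono (by linarith), IsSchurBound.zero, fun x y => ?_⟩
    by_cases hx : x < 0
    · by_cases hy : r < y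
      · have : y - x ≠ 0 := by linarith
        simp [hx, hx.le, hy, hy.le]
        field_simp
        ring
      · simp [hy]
    · simp [hx]
  have h22 : IsDiffBound (fun x y => if (0 ≤ x ∧ x ≤ r) ∧ (0 ≤ y ∧ y ≤ r) then x - y else 0) 1 0 := by
    have hM := IsSchurBound.rankOne zero_le_one zero_le_one
      (α := fun x => if 0 ≤ x ∧ x ≤ r then 1 else 0)
      (β := fun x => if 0 ≤ x ∧ x ≤ r then 1 else 0)
      (by intro x; split_ifs <;> simp) (by intro x; split_ifs <;> simp)
    refine ⟨_, _, hM.mono (by linarith), IsSchurBound.zero, fun x y => ?_⟩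
    by_cases hx : 0 ≤ x ∧ x ≤ r <;> by_cases hy : 0 ≤ y ∧ y ≤ r <;>
      simp only [hx, hy, and_self, and_true, and_false, if_true, if_false] <;> simp
  have h := (((h22.add h13.neg).add h13.swap).add (h12.neg.add h12.swap)).add
    ((h12.reflect r).add (h12.reflect r).swap.neg)
  obtain ⟨M, E, hM, hE, e⟩ := h
  refine ⟨M, E, hM.mono (by linarith), hE.mono (by linarith), fun x y => ?_⟩
  rw [← e]
  have a1 : r - x < 0 ↔ r < x := by constructor <;> intro <;> linarith
  have a2 : r - y < 0 ↔ r < y := by constructor <;> intro <;> linarith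
  have a3 : r - x ≤ r ↔ 0 ≤ x := by constructor <;> intro <;> linarith
  have a4 : r - y ≤ r ↔ 0 ≤ y := by constructor <;> intro <;> linarith
  have a5 : 0 ≤ r - x ↔ x ≤ r := by constructor <;> intro <;> linarith
  have a6 : 0 ≤ r - y ↔ y ≤ r := by constructor <;> intro <;> linarith
  simp only [a1, a2, a3, a4, a5, a6]
  have tri : ∀ x : ℝ, (x < 0 ∧ ¬ 0 ≤ x ∧ x ≤ r ∧ ¬ r < x ∧ min (max x 0) r = 0) ∨
      (¬ x < 0 ∧ 0 ≤ x ∧ x ≤ r ∧ ¬ r < x ∧ min (max x 0) r = x) ∨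
      (¬ x < 0 ∧ 0 ≤ x ∧ ¬ x ≤ r ∧ r < x ∧ min (max x 0) r = r) := by
    intro x
    rcases lt_or_ge x 0 with h | h
    · exact Or.inl ⟨h, not_le.2 h, by linarith, by linarith, by
        rw [max_eq_right h.le, min_eq_left hr0.le]⟩
    · rcases le_or_gt x r with h' | h'
      · exact Or.inr (Or.inl ⟨not_lt.2 h, h, h', not_lt.2 h', by
          rw [max_eq_left h, min_eq_left h']⟩)
      · exact Or.inr (Or.inr ⟨not_lt.2 h, h, not_le.2 h', h', by
          rw [max_eq_left h, min_eq_right h'.le]⟩)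
  rcases tri x with ⟨x1, x2, x3, x4, x5⟩ | ⟨x1, x2, x3, x4, x5⟩ | ⟨x1, x2, x3, x4, x5⟩ <;>
  rcases tri y with ⟨y1, y2, y3, y4, y5⟩ | ⟨y1, y2, y3, y4, y5⟩ | ⟨y1, y2, y3, y4, y5⟩ <;>
  simp only [x1, x2, x3, x4, x5, y1, y2, y3, y4, y5, and_self, and_true, and_false,
    if_true, if_false] <;> ring

end IsDiffBound

section Spectral

open scoped InnerProductSpace

variable {E : Type*} [NormedAddCommGroup E] [InnerProductSpace ℂ E]

lemma l2Norm_inner_right {n : ℕ} (u : OrthonormalBasis (Fin n) ℂ E) (z : E) :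
    l2Norm (fun i => ⟪u i, z⟫_ℂ) = ‖z‖ := by
  rw [l2Norm, u.sum_sq_norm_inner_right, Real.sqrt_sq (norm_nonneg _)]

lemma l2Norm_inner_left {n : ℕ} (u : OrthonormalBasis (Fin n) ℂ E) (z : E) :
    l2Norm (fun i => ⟪z, u i⟫_ℂ) = ‖z‖ := by
  rw [l2Norm, u.sum_sq_norm_inner_left, Real.sqrt_sq (norm_nonneg _)]

lemma isBilinBound_inner {n m : ℕ} (u : OrthonormalBasis (Fin n) ℂ E)
    (v : OrthonormalBasis (Fin m) ℂ E) (D : E →ₗ[ℂ] E) {δ : ℝ}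
    (hD : ∀ x, ‖D x‖ ≤ δ * ‖x‖) : IsBilinBound (fun i j => ⟪u i, D (v j)⟫_ℂ) δ := by
  intro ξ η
  set x : E := ∑ i, (starRingEnd ℂ) (ξ i) • u i with hx
  set y : E := ∑ j, η j • v j with hy
  have hxn : l2Norm ξ = ‖x‖ := by
    rw [← l2Norm_inner_left u x]
    congr 1
    funext i
    simp [hx, orthonormal_iff_ite.1 u.orthonormal]
  have hyn : l2Norm η = ‖y‖ := by
    rw [← l2Norm_inner_right v y]
    congr 1
    funext i
    simp [hy, orthonormal_iff_ite.1 v.orthonormal]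
  have e : ∑ i, ∑ j, ξ i * ⟪u i, D (v j)⟫_ℂ * η j = ⟪x, D y⟫_ℂ := by
    rw [hx, sum_inner]
    refine Finset.sum_congr rfl fun i _ => ?_
    rw [hy, map_sum, inner_sum]
    refine Finset.sum_congr rfl fun j _ => ?_
    rw [map_smul, inner_smul_left, inner_smul_right, Complex.conj_conj]
    ring
  rw [e, hxn, hyn]
  calc _ ≤ ‖x‖ * ‖D y‖ := norm_inner_le_norm _ _
    _ ≤ ‖x‖ * (δ * ‖y‖) := by gcongr; exact hD y
    _ = _ := by ring

lemma pow_apply_eigenvector {T : E →ₗ[ℂ] E} {v : E} {b : ℝ} (h : T v = (b : ℂ) • v) (k : ℕ) :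
    (T ^ k) v = (b : ℂ) ^ k • v := by
  induction k with
  | zero => simp
  | succ k ih => rw [pow_succ, Module.End.mul_apply, h, map_smul, ih, smul_smul, pow_succ']

lemma abs_eigenvalue_le {T : E →ₗ[ℂ] E} {R : ℝ} (hT : ∀ x, ‖T x‖ ≤ R * ‖x‖) {v : E}
    (hv : ‖v‖ = 1) {b : ℝ} (h : T v = (b : ℂ) • v) : |b| ≤ R := by
  simpa [h, norm_smul, hv] using hT v

/-- Schur multiplier estimate for polynomials of self-adjoint operators in finite dimension. -/
lemma norm_polynomial_sub_le_of_finiteDimensional [FiniteDimensional ℂ E] {S T : E →ₗ[ℂ] E}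
    (hS : S.IsSymmetric) (hT : T.IsSymmetric) {R δ ε K₁ K₂ : ℝ}
    (hSR : ∀ x, ‖S x‖ ≤ R * ‖x‖) (hTR : ∀ x, ‖T x‖ ≤ R * ‖x‖) (hδ : 0 ≤ δ) (hε : 0 ≤ ε)
    (hK₁ : 0 ≤ K₁) (hK₂ : 0 ≤ K₂)
    (hST : ∀ x, ‖(S - T) x‖ ≤ δ * ‖x‖) {f : ℝ → ℝ} (P : Polynomial ℝ)
    (hP : ∀ t ∈ Set.Icc (-R) R, |P.eval t - f t| ≤ ε)
    (hf : IsDiffBound (fun x y => f x - f y) K₁ K₂) (y : E) :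
    ‖∑ k ∈ Finset.range (P.natDegree + 1), (P.coeff k : ℂ) • ((S ^ k) y - (T ^ k) y)‖
      ≤ (K₁ * δ + K₂ + 2 * ε) * ‖y‖ := by
  classical
  set z := ∑ k ∈ Finset.range (P.natDegree + 1), (P.coeff k : ℂ) • ((S ^ k) y - (T ^ k) y) with hz
  set u := hS.eigenvectorBasis rfl
  set v := hT.eigenvectorBasis rfl
  set a := hS.eigenvalues rfl
  set b := hT.eigenvalues rfl
  have hu : ∀ i, S (u i) = (a i : ℂ) • u i := hS.apply_eigenvectorBasis rfl
  have hv : ∀ i, T (v i) = (b i : ℂ) • v i := hT.apply_eigenvectorBasis rfl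
  have haR : ∀ i, |a i| ≤ R := fun i => abs_eigenvalue_le hSR (u.orthonormal.1 i) (hu i)
  have hbR : ∀ i, |b i| ≤ R := fun i => abs_eigenvalue_le hTR (v.orthonormal.1 i) (hv i)
  set e : ℝ → ℝ := fun t => if |t| ≤ R then P.eval t - f t else 0 with he
  have hee : ∀ t, |e t| ≤ ε := by
    intro t
    simp only [he]
    split_ifs with h
    · exact hP t (abs_le.1 h)
    · simpa using hε
  have hpe : ∀ t, |t| ≤ R → P.eval t = f t + e t := by
    intro t ht
    simp [he, ht]
  obtain ⟨M, N, hM, hN, hMN⟩ := hf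
  have hN' := (hN.add (IsSchurBound.rankOne hε zero_le_one (α := e) (β := fun _ => 1) hee
    (by simp))).add (IsSchurBound.rankOne hε zero_le_one (α := e) (β := fun _ => 1) hee
    (by simp)).swap.neg
  set N' := fun x y => (N x y + e x * 1) + -(e y * 1) with hN'def
  have hD := hM _ _ a b _ δ hδ (isBilinBound_inner u v (S - T) hST)
  have hW := hN' _ _ a b _ 1 zero_le_one (isBilinBound_inner u v LinearMap.id (by simp))
  have hcoef : ∀ i, ⟪u i, z⟫_ℂ = ∑ j, ((M (a i) (b j) : ℂ) * ⟪u i, (S - T) (v j)⟫_ℂ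
      + (N' (a i) (b j) : ℂ) * ⟪u i, (LinearMap.id : E →ₗ[ℂ] E) (v j)⟫_ℂ) * ⟪v j, y⟫_ℂ := by
    intro i
    have h1 : ∀ k, ⟪u i, (S ^ k) y⟫_ℂ = ∑ j, (a i : ℂ) ^ k * (⟪u i, v j⟫_ℂ * ⟪v j, y⟫_ℂ) := by
      intro k
      rw [← (hS.pow k) (u i) y, pow_apply_eigenvector (hu i), inner_smul_left, ← Finset.mul_sum,
        v.sum_inner_mul_inner]
      simp
    have h2 : ∀ k, ⟪u i, (T ^ k) y⟫_ℂ = ∑ j, (b j : ℂ) ^ k * (⟪u i, v j⟫_ℂ * ⟪v j, y⟫_ℂ) := by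
      intro k
      rw [← v.sum_inner_mul_inner]
      refine Finset.sum_congr rfl fun j _ => ?_
      rw [← (hT.pow k) (v j) y, pow_apply_eigenvector (hv j), inner_smul_left]
      simp only [map_pow, Complex.conj_ofReal]
      ring
    have h3 : ∀ j, (M (a i) (b j) : ℂ) * ⟪u i, (S - T) (v j)⟫_ℂ
        + (N' (a i) (b j) : ℂ) * ⟪u i, (LinearMap.id : E →ₗ[ℂ] E) (v j)⟫_ℂ
        = ((P.eval (a i) - P.eval (b j) : ℝ) : ℂ) * ⟪u i, v j⟫_ℂ := by
      intro j
      have : ⟪u i, (S - T) (v j)⟫_ℂ = ((a i - b j : ℝ) : ℂ) * ⟪u i, v j⟫_ℂ := by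
        rw [LinearMap.sub_apply, inner_sub_right, ← hS (u i) (v j), hu, hv, inner_smul_left,
          inner_smul_right]
        simp
        ring
      rw [this, hpe _ (haR i), hpe _ (hbR j), LinearMap.id_apply]
      have := hMN (a i) (b j)
      rw [show f (a i) + e (a i) - (f (b j) + e (b j))
        = M (a i) (b j) * (a i - b j) + N' (a i) (b j) by simp only [hN'def]; linarith]
      push_cast
      ring
    simp only [h3]
    rw [hz, inner_sum]
    simp only [inner_smul_right, inner_sub_right, h1, h2, ← Finset.sum_sub_distrib, Finset.mul_sum]
    rw [Finset.sum_comm]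
    refine Finset.sum_congr rfl fun j _ => ?_
    rw [Polynomial.eval_eq_sum_range, Polynomial.eval_eq_sum_range, ← Finset.sum_sub_distrib]
    push_cast
    rw [Finset.sum_mul, Finset.sum_mul]
    refine Finset.sum_congr rfl fun k _ => ?_
    ring
  have hzz : ‖z‖ * ‖z‖ ≤ (K₁ * δ + K₂ + 2 * ε) * ‖y‖ * ‖z‖ := by
    have h0 : ⟪z, z⟫_ℂ = (∑ i, ∑ j, ⟪z, u i⟫_ℂ * ((M (a i) (b j) : ℂ) * ⟪u i, (S - T) (v j)⟫_ℂ)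
          * ⟪v j, y⟫_ℂ)
        + ∑ i, ∑ j, ⟪z, u i⟫_ℂ * ((N' (a i) (b j) : ℂ) * ⟪u i, (LinearMap.id : E →ₗ[ℂ] E) (v j)⟫_ℂ)
          * ⟪v j, y⟫_ℂ := by
      rw [← u.sum_inner_mul_inner z z, ← Finset.sum_add_distrib]
      refine Finset.sum_congr rfl fun i _ => ?_
      rw [hcoef, Finset.mul_sum, ← Finset.sum_add_distrib]
      refine Finset.sum_congr rfl fun j _ => ?_
      ring
    have h1 := hD (fun i => ⟪z, u i⟫_ℂ) (fun j => ⟪v j, y⟫_ℂ)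
    have h2 := hW (fun i => ⟪z, u i⟫_ℂ) (fun j => ⟪v j, y⟫_ℂ)
    rw [l2Norm_inner_left, l2Norm_inner_right] at h1 h2
    have h3 : ‖⟪z, z⟫_ℂ‖ = ‖z‖ * ‖z‖ := by
      rw [inner_self_eq_norm_sq_to_K]
      simp [sq]
    rw [← h3, h0]
    refine (norm_add_le _ _).trans ((add_le_add h1 h2).trans (le_of_eq ?_))
    ring
  rcases (norm_nonneg z).eq_or_lt with h | h
  · rw [← h]
    positivity
  · exact le_of_mul_le_mul_right hzz h

end Spectral

section HilbertSpace

variable {H : Type*} [NormedAddCommGroup H] [InnerProductSpace ℂ H]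

/-- The compression of `A` to a subspace. -/
noncomputable def compression (V : Submodule ℂ H) [V.HasOrthogonalProjection] (A : H →L[ℂ] H) :
    V →ₗ[ℂ] V :=
  (V.orthogonalProjectionOnto ∘L A ∘L V.subtypeL : V →L[ℂ] V)

lemma compression_apply (V : Submodule ℂ H) [V.HasOrthogonalProjection] (A : H →L[ℂ] H) (x : V) :
    compression V A x = V.orthogonalProjectionOnto (A x) := rfl

lemma compression_isSymmetric [CompleteSpace H] (V : Submodule ℂ H) [V.HasOrthogonalProjection] {A : H →L[ℂ] H}
    (hA : IsSelfAdjoint A) : (compression V A).IsSymmetric := by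
  intro x y
  have h := (ContinuousLinearMap.isSelfAdjoint_iff_isSymmetric.1 hA) (x : H) (y : H)
  rw [compression_apply, compression_apply, V.inner_orthogonalProjectionOnto_eq_of_mem_left,
    V.inner_orthogonalProjectionOnto_eq_of_mem_right]
  exact h

lemma norm_compression_apply_le (V : Submodule ℂ H) [V.HasOrthogonalProjection] (A : H →L[ℂ] H)
    (x : V) : ‖compression V A x‖ ≤ ‖A‖ * ‖x‖ :=
  (V.norm_orthogonalProjectionOnto_apply_le _).trans (A.le_opNorm x)

lemma compression_pow_apply (V : Submodule ℂ H) [V.HasOrthogonalProjection] (A : H →L[ℂ] H)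
    (x : V) {d : ℕ} (h : ∀ k ≤ d, (A ^ k) (x : H) ∈ V) :
    ∀ k ≤ d, (((compression V A) ^ k) x : H) = (A ^ k) (x : H) := by
  intro k
  induction k with
  | zero => simp
  | succ k ih =>
    intro hk
    rw [pow_succ', Module.End.mul_apply, compression_apply, ih (by omega)]
    have e : A ((A ^ k) (x : H)) = (A ^ (k + 1)) (x : H) := by
      rw [pow_succ', mul_apply_eq_comp]
    rw [e]
    exact congrArg Subtype.val
      (V.orthogonalProjectionOnto_mem_subspace_eq_self ⟨_, h (k + 1) hk⟩)

variable [CompleteSpace H]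

lemma abs_le_norm_of_mem_spectrum {A : H →L[ℂ] H} {t : ℝ} (ht : t ∈ spectrum ℝ A) :
    |t| ≤ ‖A‖ := by
  refine (spectrum.norm_le_norm_mul_of_mem ht).trans ?_
  exact mul_le_of_le_one_right (norm_nonneg _) ContinuousLinearMap.norm_id_le

lemma norm_polynomial_sub_le {A B : H →L[ℂ] H} (hA : IsSelfAdjoint A) (hB : IsSelfAdjoint B)
    {R δ ε K₁ K₂ : ℝ} (hAR : ‖A‖ ≤ R) (hBR : ‖B‖ ≤ R) (hAB : ‖A - B‖ ≤ δ) (hε : 0 ≤ ε)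
    (hK₁ : 0 ≤ K₁) (hK₂ : 0 ≤ K₂) {f : ℝ → ℝ} (P : Polynomial ℝ)
    (hP : ∀ t ∈ Set.Icc (-R) R, |P.eval t - f t| ≤ ε)
    (hf : IsDiffBound (fun x y => f x - f y) K₁ K₂) :
    ‖Polynomial.aeval A P - Polynomial.aeval B P‖ ≤ K₁ * δ + K₂ + 2 * ε := by
  have hδ : 0 ≤ δ := (norm_nonneg _).trans hAB
  refine ContinuousLinearMap.opNorm_le_bound _ (by positivity) fun y => ?_
  set d := P.natDegree
  let w : Fin (d + 1) ⊕ Fin (d + 1) → H :=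
    Sum.elim (fun k => (A ^ (k : ℕ)) y) (fun k => (B ^ (k : ℕ)) y)
  let V : Submodule ℂ H := Submodule.span ℂ (Set.range w)
  have : FiniteDimensional ℂ V := FiniteDimensional.span_of_finite ℂ (Set.finite_range w)
  have hVA : ∀ k ≤ d, (A ^ k) y ∈ V := fun k hk =>
    Submodule.subset_span ⟨Sum.inl ⟨k, by omega⟩, rfl⟩
  have hVB : ∀ k ≤ d, (B ^ k) y ∈ V := fun k hk =>
    Submodule.subset_span ⟨Sum.inr ⟨k, by omega⟩, rfl⟩
  let y' : V := ⟨y, by simpa using hVA 0 (Nat.zero_le _)⟩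
  have h := norm_polynomial_sub_le_of_finiteDimensional (compression_isSymmetric V hA)
    (compression_isSymmetric V hB)
    (fun x => (norm_compression_apply_le V A x).trans (by gcongr))
    (fun x => (norm_compression_apply_le V B x).trans (by gcongr)) hδ hε hK₁ hK₂
    (fun x => by
      have e : (compression V A - compression V B) x = compression V (A - B) x := by
        simp [compression_apply]
      rw [e]
      exact (norm_compression_apply_le V _ x).trans (by gcongr)) P hP hf y'
  refine le_of_eq_of_le ?_ h
  rw [Submodule.coe_norm]
  congr 1
  rw [Polynomial.aeval_eq_sum_range, Polynomial.aeval_eq_sum_range, ← Finset.sum_sub_distrib,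
    sum_apply, Submodule.coe_sum]
  refine Finset.sum_congr rfl fun k hk => ?_
  have hk' : k ≤ d := by
    have := Finset.mem_range.1 hk
    omega
  rw [Submodule.coe_smul, Submodule.coe_sub, compression_pow_apply V A y' hVA k hk',
    compression_pow_apply V B y' hVB k hk', ← smul_sub]
  rfl

/-- Operator Lipschitz type estimate from a Schur multiplier splitting of `f x - f y`. -/
lemma norm_cfc_sub_le {A B : H →L[ℂ] H} (hA : IsSelfAdjoint A) (hB : IsSelfAdjoint B)
    {δ K₁ K₂ : ℝ} (hAB : ‖A - B‖ ≤ δ) (hK₁ : 0 ≤ K₁) (hK₂ : 0 ≤ K₂) {f : ℝ → ℝ}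
    (hfc : Continuous f) (hf : IsDiffBound (fun x y => f x - f y) K₁ K₂) :
    ‖cfc f A - cfc f B‖ ≤ K₁ * δ + K₂ := by
  refine le_of_forall_pos_le_add fun ε hε => ?_
  set R := max ‖A‖ ‖B‖
  obtain ⟨P, hP⟩ := exists_polynomial_near_of_continuousOn (-R) R f hfc.continuousOn (ε / 4)
    (by positivity)
  have hclose : ∀ T : H →L[ℂ] H, IsSelfAdjoint T → ‖T‖ ≤ R →
      ‖Polynomial.aeval T P - cfc f T‖ ≤ ε / 4 := by
    intro T hT hTR
    rw [← cfc_polynomial P T hT, ← cfc_sub _ _ T (by fun_prop) hfc.continuousOn]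
    refine norm_cfc_le (by positivity) fun t ht => (hP t (abs_le.1 ?_)).le
    exact (abs_le_norm_of_mem_spectrum ht).trans hTR
  have h := norm_polynomial_sub_le hA hB (le_max_left _ _) (le_max_right _ _) hAB
    (by positivity : 0 ≤ ε / 4) hK₁ hK₂ P (fun t ht => (hP t ht).le) hf
  have hA' := hclose A hA (le_max_left _ _)
  have hB' := hclose B hB (le_max_right _ _)
  calc ‖cfc f A - cfc f B‖
      = ‖-(Polynomial.aeval A P - cfc f A) + (Polynomial.aeval A P - Polynomial.aeval B P)
          + (Polynomial.aeval B P - cfc f B)‖ := by congr 1; abel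
    _ ≤ ‖Polynomial.aeval A P - cfc f A‖ + ‖Polynomial.aeval A P - Polynomial.aeval B P‖
          + ‖Polynomial.aeval B P - cfc f B‖ := by
        refine (norm_add₃_le).trans ?_
        rw [norm_neg]
    _ ≤ _ := by linarith

end HilbertSpace

lemma norm_cfc_truncation_sub_le {H : Type*} [NormedAddCommGroup H] [InnerProductSpace ℂ H]
    [CompleteSpace H] {A B : H →L[ℂ] H} (hA : IsSelfAdjoint A) (hB : IsSelfAdjoint B) {δ r : ℝ}
    (hδ : 0 < δ) (hAB : ‖A - B‖ ≤ δ) (hr0 : 0 < r) {k : ℕ} (hr : r ≤ δ * 2 ^ 2 ^ k) :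
    ‖cfc (fun t => min (max t 0) r) A - cfc (fun t => min (max t 0) r) B‖
      ≤ 15 * (δ * (k + 1)) := by
  refine (norm_cfc_sub_le hA hB hAB (by positivity) (by positivity) (by fun_prop)
    (IsDiffBound.truncation hδ hr0 hr)).trans ?_
  have : 0 ≤ (k : ℝ) * δ := by positivity
  linarith

section Integral

/-- The integral of `φ (δ * s) / (s ^ 2 * log s)` over `s > e`. -/
noncomputable def logIntegral (δ : ℝ) (φ : ℝ → ℝ) : ℝ≥0∞ :=
  ∫⁻ s in Set.Ioi (Real.exp 1), ENNReal.ofReal (φ (δ * s) / (s ^ 2 * Real.log s))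

lemma one_lt_log_of_exp_lt {s : ℝ} (hs : Real.exp 1 < s) : 1 < Real.log s := by
  rwa [Real.lt_log_iff_exp_lt ((Real.exp_pos 1).trans hs)]

lemma logIntegral_mono {δ : ℝ} (hδ : 0 < δ) {φ ψ : ℝ → ℝ} (h : ∀ t, 0 < t → φ t ≤ ψ t) :
    logIntegral δ φ ≤ logIntegral δ ψ := by
  refine setLIntegral_mono' measurableSet_Ioi fun s hs => ?_
  have hs0 : 0 < s := (Real.exp_pos 1).trans hs
  have := one_lt_log_of_exp_lt hs
  gcongr
  exact h _ (by positivity)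

lemma logIntegral_add (δ : ℝ) {φ ψ : ℝ → ℝ} (hφ : Continuous φ) (hφ0 : ∀ t, 0 ≤ φ t)
    (hψ0 : ∀ t, 0 ≤ ψ t) :
    logIntegral δ (fun t => φ t + ψ t) = logIntegral δ φ + logIntegral δ ψ := by
  unfold logIntegral
  rw [← lintegral_add_left (by
    have : Measurable fun s => φ (δ * s) := (hφ.comp (continuous_const_mul δ)).measurable
    fun_prop)]
  refine setLIntegral_congr_fun measurableSet_Ioi fun s hs => ?_
  have := one_lt_log_of_exp_lt hs
  simp only
  rw [← ENNReal.ofReal_add (div_nonneg (hφ0 _) (by positivity))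
    (div_nonneg (hψ0 _) (by positivity)), add_div]

lemma logIntegral_const_mul (δ : ℝ) {φ : ℝ → ℝ} {a : ℝ} (ha : 0 ≤ a) :
    logIntegral δ (fun t => a * φ t) = ENNReal.ofReal a * logIntegral δ φ := by
  unfold logIntegral
  rw [← lintegral_const_mul' _ _ ENNReal.ofReal_ne_top]
  simp only [mul_div_assoc, ENNReal.ofReal_mul ha]

lemma le_logIntegral {δ : ℝ} {φ : ℝ → ℝ} {v : ℝ} (hv : 0 ≤ v)
    (h : ∀ s, 1 ≤ s → v ≤ φ (δ * s)) : ENNReal.ofReal (v / 32) ≤ logIntegral δ φ := by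
  have he : Real.exp 1 < 3 := by have := Real.exp_one_lt_d9; linarith
  have hmeas : (1 : ℝ≥0∞) ≤ volume (Set.Ioc (Real.exp 1) 4) := by
    rw [Real.volume_Ioc, ← ENNReal.ofReal_one]
    exact ENNReal.ofReal_le_ofReal (by linarith)
  calc ENNReal.ofReal (v / 32) ≤ ENNReal.ofReal (v / 32) * volume (Set.Ioc (Real.exp 1) 4) :=
        le_mul_of_one_le_right' hmeas
    _ = ∫⁻ _ in Set.Ioc (Real.exp 1) 4, ENNReal.ofReal (v / 32) := by rw [setLIntegral_const]
    _ ≤ ∫⁻ s in Set.Ioc (Real.exp 1) 4, ENNReal.ofReal (φ (δ * s) / (s ^ 2 * Real.log s)) := by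
        refine setLIntegral_mono' measurableSet_Ioc fun s hs => ENNReal.ofReal_le_ofReal ?_
        have h1 := one_lt_log_of_exp_lt hs.1
        have h2 : Real.exp 1 < s := hs.1
        have h3 : (1 : ℝ) < s := by have := Real.add_one_le_exp (1 : ℝ); linarith
        have h4 : Real.log s ≤ 2 := by
          have : Real.log s ≤ Real.log 4 := Real.log_le_log (by linarith) hs.2
          have e : Real.log 4 = 2 * Real.log 2 := by
            rw [show (4 : ℝ) = 2 ^ 2 by norm_num, Real.log_pow]
            norm_num
          have := Real.log_two_lt_d9
          linarith
        have h5 : s ^ 2 ≤ 16 := by nlinarith [hs.2]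
        have h6 : s ^ 2 * Real.log s ≤ 32 := by nlinarith
        have h7 := h s h3.le
        exact div_le_div₀ (hv.trans h7) h7 (by positivity) h6
    _ ≤ _ := lintegral_mono_set Set.Ioc_subset_Ioi_self

lemma le_logIntegral_truncation {δ : ℝ} (hδ : 0 < δ) {x : ℝ} (hx : Real.exp 1 ≤ x) :
    ENNReal.ofReal (δ * Real.log (Real.log x))
      ≤ logIntegral δ (fun t => min (max t 0) (x * δ)) := by
  have hpos : ∀ s ∈ Set.Icc (Real.exp 1) x, 0 < s ∧ 1 ≤ Real.log s := by
    intro s hs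
    have h0 : 0 < s := (Real.exp_pos 1).trans_le hs.1
    exact ⟨h0, (Real.le_log_iff_exp_le h0).2 hs.1⟩
  have hcont : ContinuousOn (fun s => δ * (s⁻¹ / Real.log s)) (Set.Icc (Real.exp 1) x) := by
    intro s hs
    obtain ⟨h0, h1⟩ := hpos s hs
    have h2 : Real.log s ≠ 0 := by linarith
    refine ContinuousAt.continuousWithinAt ?_
    exact continuousAt_const.mul ((continuousAt_inv₀ h0.ne').div (Real.continuousAt_log h0.ne') h2)
  have hint : ∫ s in (Real.exp 1)..x, δ * (s⁻¹ / Real.log s) = δ * Real.log (Real.log x) := by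
    rw [intervalIntegral.integral_eq_sub_of_hasDerivAt
      (f := fun s => δ * Real.log (Real.log s))]
    · simp
    · intro s hs
      rw [Set.uIcc_of_le hx] at hs
      obtain ⟨h0, h1⟩ := hpos s hs
      exact ((Real.hasDerivAt_log h0.ne').log (by linarith)).const_mul δ
    · exact ContinuousOn.intervalIntegrable (by rwa [Set.uIcc_of_le hx])
  rw [← hint, intervalIntegral.integral_of_le hx, ofReal_integral_eq_lintegral_ofReal]
  · refine le_trans (setLIntegral_mono' measurableSet_Ioc fun s hs => ?_)
      (lintegral_mono_set Set.Ioc_subset_Ioi_self)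
    obtain ⟨h0, h1⟩ := hpos s (Set.Ioc_subset_Icc_self hs)
    refine ENNReal.ofReal_le_ofReal (le_of_eq ?_)
    have hxδ : δ * s ≤ x * δ := by nlinarith [hs.2]
    simp only [max_eq_left (mul_pos hδ h0).le, min_eq_left hxδ]
    have : Real.log s ≠ 0 := by linarith
    field_simp
  · exact hcont.integrableOn_Icc.mono_set Set.Ioc_subset_Icc_self
  · refine (ae_restrict_iff' measurableSet_Ioc).2 (Filter.Eventually.of_forall fun s hs => ?_)
    obtain ⟨h0, h1⟩ := hpos s (Set.Ioc_subset_Icc_self hs)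
    simp only [Pi.zero_apply]
    positivity

/-- The double logarithm of the truncation level is controlled by the integral. -/
lemma exists_le_logIntegral_truncation {δ : ℝ} (hδ : 0 < δ) {n : ℕ} (hn : 1 ≤ n) :
    ∃ k : ℕ, (n : ℝ) * δ ≤ δ * 2 ^ 2 ^ k ∧
      ENNReal.ofReal (δ * (k + 1) / 128) ≤ logIntegral δ (fun t => min (max t 0) (n * δ)) := by
  have hn' : (1 : ℝ) ≤ n := by exact_mod_cast hn
  have hsmall : ENNReal.ofReal (δ / 32) ≤ logIntegral δ (fun t => min (max t 0) (n * δ)) := by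
    refine le_logIntegral hδ.le fun s hs => ?_
    rw [max_eq_left (by positivity)]
    exact le_min (by nlinarith) (by nlinarith)
  refine ⟨Nat.clog 2 (Nat.clog 2 n), ?_, ?_⟩
  · have h : n ≤ 2 ^ 2 ^ Nat.clog 2 (Nat.clog 2 n) :=
      (Nat.le_pow_clog one_lt_two n).trans
        (Nat.pow_le_pow_right two_pos (Nat.le_pow_clog one_lt_two _))
    have h' : (n : ℝ) ≤ 2 ^ 2 ^ Nat.clog 2 (Nat.clog 2 n) := by exact_mod_cast h
    nlinarith
  · rcases le_or_gt (Nat.clog 2 (Nat.clog 2 n)) 3 with hk | hk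
    · refine le_trans (ENNReal.ofReal_le_ofReal ?_) hsmall
      have : ((Nat.clog 2 (Nat.clog 2 n) : ℕ) : ℝ) ≤ 3 := by exact_mod_cast hk
      nlinarith
    · obtain ⟨m, hm⟩ : ∃ m, Nat.clog 2 (Nat.clog 2 n) = m + 1 := ⟨_, (Nat.succ_pred (by omega)).symm⟩
      have h1 : 2 ^ m < Nat.clog 2 n := (Nat.lt_clog_iff_pow_lt one_lt_two).1 (by omega)
      have h2 : 2 ^ 2 ^ m < n := (Nat.lt_clog_iff_pow_lt one_lt_two).1 h1
      have h2' : (2 : ℝ) ^ 2 ^ m ≤ n := by exact_mod_cast h2.le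
      have hm3 : 3 ≤ m := by omega
      have hm3' : (3 : ℝ) ≤ m := by exact_mod_cast hm3
      have hl2 := Real.log_two_gt_d9
      have h3 : (2 : ℝ) ^ m * Real.log 2 ≤ Real.log n := by
        have := Real.log_le_log (by positivity) h2'
        rw [Real.log_pow] at this
        exact_mod_cast this
      have h4 : m * Real.log 2 + Real.log (Real.log 2) ≤ Real.log (Real.log n) := by
        have := Real.log_le_log (by positivity) h3
        rwa [Real.log_mul (by positivity) (by positivity), Real.log_pow] at this
      have h5 : -1 / 2 ≤ Real.log (Real.log 2) := by
        have := Real.one_sub_inv_le_log_of_pos (show 0 < Real.log 2 by positivity)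
        have h6 : (Real.log 2)⁻¹ ≤ 3 / 2 := by
          rw [inv_le_comm₀ (by positivity) (by positivity)]
          linarith
        linarith
      have h7 : Real.exp 1 ≤ n := by
        have h8 : (2 : ℝ) ^ 2 ≤ 2 ^ 2 ^ m := pow_le_pow_right₀ one_le_two (by
          calc 2 = 2 ^ 1 := rfl
            _ ≤ 2 ^ m := Nat.pow_le_pow_right two_pos (by omega))
        have := Real.exp_one_lt_d9
        linarith
      refine le_trans (ENNReal.ofReal_le_ofReal ?_) (le_logIntegral_truncation hδ h7)
      rw [hm, mul_div_assoc]
      refine mul_le_mul_of_nonneg_left ?_ hδ.le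
      push_cast
      nlinarith

end Integral

section Interpolation

/-- The piecewise linear interpolation of `f` at the nodes `j * δ`, `j ≤ N`, written as a
combination of truncations. -/
noncomputable def interp (f : ℝ → ℝ) (δ : ℝ) (N : ℕ) (t : ℝ) : ℝ :=
  ∑ j ∈ Finset.range N, (f ((j + 1 : ℕ) * δ) - f (j * δ)) / δ *
    (min (max t 0) ((j + 1 : ℕ) * δ) - min (max t 0) (j * δ))

lemma sum_mul_sub_eq (d h : ℕ → ℝ) (h0 : h 0 = 0) (N : ℕ) :
    ∑ j ∈ Finset.range N, d j * (h (j + 1) - h j)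
      = ∑ j ∈ Finset.range N, (d j - d (j + 1)) * h (j + 1) + d N * h N := by
  induction N with
  | zero => simp [h0]
  | succ N ih =>
    rw [Finset.sum_range_succ, Finset.sum_range_succ, ih]
    ring

variable {f : ℝ → ℝ} {δ : ℝ}

lemma slope_antitone (hf : ConcaveOn ℝ (Set.Ici 0) f) (hδ : 0 < δ) :
    Antitone fun j : ℕ => (f ((j + 1 : ℕ) * δ) - f (j * δ)) / δ := by
  refine antitone_nat_of_succ_le fun j => ?_
  have h := hf.2 (show (j : ℝ) * δ ∈ Set.Ici 0 from Set.mem_Ici.2 (by positivity))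
    (show ((j + 1 + 1 : ℕ) : ℝ) * δ ∈ Set.Ici 0 from Set.mem_Ici.2 (by positivity))
    (show (0 : ℝ) ≤ 1 / 2 by norm_num) (show (0 : ℝ) ≤ 1 / 2 by norm_num) (by norm_num)
  have e : (1 / 2 : ℝ) • (j * δ) + (1 / 2 : ℝ) • ((j + 1 + 1 : ℕ) * δ) = (j + 1 : ℕ) * δ := by
    simp only [smul_eq_mul]
    push_cast
    ring
  rw [e] at h
  simp only [smul_eq_mul] at h
  exact div_le_div_of_nonneg_right (by linarith) hδ.le

lemma interp_bounds (hf : ConcaveOn ℝ (Set.Ici 0) f) (hmono : Monotone f) (hf0 : f 0 = 0)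
    (hδ : 0 < δ) (N : ℕ) :
    (∀ t, 0 ≤ t → t ≤ N * δ → interp f δ N t ≤ f t ∧ f t ≤ interp f δ N t + f δ) ∧
      ∀ t, N * δ ≤ t → interp f δ N t = f (N * δ) := by
  induction N with
  | zero =>
    have hδ0 : 0 ≤ f δ := hf0 ▸ hmono hδ.le
    refine ⟨fun t h0 h1 => ?_, fun t _ => by simp [interp, hf0]⟩
    have : t = 0 := le_antisymm (by simpa using h1) h0
    simp [interp, this, hf0, hδ0]
  | succ N ih =>
    have hstep : ∀ t, interp f δ (N + 1) t = interp f δ N t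
        + (f ((N + 1 : ℕ) * δ) - f (N * δ)) / δ *
          (min (max t 0) ((N + 1 : ℕ) * δ) - min (max t 0) (N * δ)) := by
      intro t
      simp only [interp, Finset.sum_range_succ]
    have hN : (0 : ℝ) ≤ N * δ := by positivity
    have hNN : ((N + 1 : ℕ) : ℝ) * δ = N * δ + δ := by
      push_cast
      ring
    constructor
    · intro t h0 h1
      rw [hstep, max_eq_left h0, min_eq_left h1]
      rcases le_or_gt t (N * δ) with h | h
      · rw [min_eq_left h, sub_self, mul_zero, add_zero]
        exact ih.1 t h0 h
      · rw [min_eq_right h.le, ih.2 t h.le]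
        have hd : f ((N + 1 : ℕ) * δ) - f (N * δ) ≤ f δ := by
          have := slope_antitone hf hδ (Nat.zero_le N)
          simp only [Nat.cast_zero, zero_mul, hf0, zero_add, Nat.cast_one, one_mul, sub_zero] at this
          exact (div_le_div_iff_of_pos_right hδ).1 this
        have hd0 : 0 ≤ f ((N + 1 : ℕ) * δ) - f (N * δ) :=
          sub_nonneg.2 (hmono (by linarith))
        constructor
        · have hc := hf.2 (show (N : ℝ) * δ ∈ Set.Ici 0 from Set.mem_Ici.2 hN)
            (show ((N + 1 : ℕ) : ℝ) * δ ∈ Set.Ici 0 from Set.mem_Ici.2 (by positivity))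
            (show 0 ≤ 1 - (t - N * δ) / δ by rw [sub_nonneg, div_le_one hδ]; linarith)
            (show 0 ≤ (t - N * δ) / δ from div_nonneg (by linarith) hδ.le) (by ring)
          have e : (1 - (t - N * δ) / δ) • (N * δ) + ((t - N * δ) / δ) • ((N + 1 : ℕ) * δ) = t := by
            rw [hNN]
            simp only [smul_eq_mul]
            field_simp
            ring
          rw [e] at hc
          simp only [smul_eq_mul] at hc
          refine le_trans (le_of_eq ?_) hc
          ring
        · have h2 : f t ≤ f ((N + 1 : ℕ) * δ) := hmono h1
          have h3 : 0 ≤ (f ((N + 1 : ℕ) * δ) - f (N * δ)) / δ * (t - N * δ) :=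
            mul_nonneg (div_nonneg hd0 hδ.le) (by linarith)
          linarith
    · intro t ht
      have h1 : N * δ ≤ t := by linarith
      rw [hstep, ih.2 t h1, max_eq_left (by linarith), min_eq_right ht, min_eq_right h1, hNN]
      field_simp
      ring

lemma interp_eq_zero (N : ℕ) (hδ : 0 < δ) {t : ℝ} (ht : t ≤ 0) : interp f δ N t = 0 := by
  refine Finset.sum_eq_zero fun j _ => ?_
  rw [max_eq_right ht, min_eq_left (by positivity), min_eq_left (by positivity)]
  simp

end Interpolation

section Combination

variable {H : Type*} [NormedAddCommGroup H] [InnerProductSpace ℂ H] [CompleteSpace H]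

/-- The integral estimate with constant `1920` for a fixed pair of operators. -/
def HasLogBound (A B : H →L[ℂ] H) (δ : ℝ) (φ : ℝ → ℝ) : Prop :=
  Continuous φ ∧ (∀ t, 0 ≤ φ t) ∧
    ENNReal.ofReal ‖cfc φ A - cfc φ B‖ ≤ ENNReal.ofReal 1920 * logIntegral δ φ

namespace HasLogBound

variable {A B : H →L[ℂ] H} {δ : ℝ} {φ ψ : ℝ → ℝ}

lemma add (hφ : HasLogBound A B δ φ) (hψ : HasLogBound A B δ ψ) :
    HasLogBound A B δ (fun t => φ t + ψ t) := by
  obtain ⟨c₁, p₁, b₁⟩ := hφ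
  obtain ⟨c₂, p₂, b₂⟩ := hψ
  refine ⟨c₁.add c₂, fun t => add_nonneg (p₁ t) (p₂ t), ?_⟩
  rw [logIntegral_add δ c₁ p₁ p₂, mul_add, cfc_add A φ ψ c₁.continuousOn c₂.continuousOn,
    cfc_add B φ ψ c₁.continuousOn c₂.continuousOn, add_sub_add_comm]
  refine le_trans (ENNReal.ofReal_le_ofReal (norm_add_le _ _)) ?_
  rw [ENNReal.ofReal_add (norm_nonneg _) (norm_nonneg _)]
  exact add_le_add b₁ b₂

lemma const_mul (hφ : HasLogBound A B δ φ) {a : ℝ} (ha : 0 ≤ a) :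
    HasLogBound A B δ (fun t => a * φ t) := by
  obtain ⟨c, p, b⟩ := hφ
  refine ⟨c.const_mul a, fun t => mul_nonneg ha (p t), ?_⟩
  rw [logIntegral_const_mul δ ha, cfc_const_mul a φ A c.continuousOn,
    cfc_const_mul a φ B c.continuousOn, ← smul_sub, norm_smul, Real.norm_of_nonneg ha,
    ENNReal.ofReal_mul ha, mul_left_comm]
  gcongr

lemma truncation (hA : IsSelfAdjoint A) (hB : IsSelfAdjoint B) (hδ : 0 < δ) (hAB : ‖A - B‖ ≤ δ)
    {n : ℕ} (hn : 1 ≤ n) : HasLogBound A B δ (fun t => min (max t 0) (n * δ)) := by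
  obtain ⟨k, hk, hI⟩ := exists_le_logIntegral_truncation hδ hn
  have hn' : (1 : ℝ) ≤ n := by exact_mod_cast hn
  refine ⟨by fun_prop, fun t => le_min (le_max_right _ _) (by positivity), ?_⟩
  calc _ ≤ ENNReal.ofReal (1920 * (δ * (k + 1) / 128)) :=
        ENNReal.ofReal_le_ofReal ((norm_cfc_truncation_sub_le hA hB hδ hAB (by positivity)
          hk).trans (by linarith))
    _ = ENNReal.ofReal 1920 * ENNReal.ofReal (δ * (k + 1) / 128) :=
        ENNReal.ofReal_mul (by norm_num)
    _ ≤ _ := by gcongr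

lemma zero : HasLogBound A B δ (fun _ => 0) :=
  ⟨continuous_const, fun _ => le_rfl, by simp⟩

lemma sum (N : ℕ) {φ : ℕ → ℝ → ℝ} (h : ∀ j, HasLogBound A B δ (φ j)) :
    HasLogBound A B δ (fun t => ∑ j ∈ Finset.range N, φ j t) := by
  induction N with
  | zero => simpa using zero
  | succ N ih =>
    simp only [Finset.sum_range_succ]
    exact ih.add (h N)

lemma interp (hA : IsSelfAdjoint A) (hB : IsSelfAdjoint B) (hδ : 0 < δ) (hAB : ‖A - B‖ ≤ δ)
    {f : ℝ → ℝ} (hf : ConcaveOn ℝ (Set.Ici 0) f) (hmono : Monotone f) {N : ℕ} (hN : 1 ≤ N) :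
    HasLogBound A B δ (interp f δ N) := by
  set d : ℕ → ℝ := fun j => (f ((j + 1 : ℕ) * δ) - f (j * δ)) / δ with hd
  have hanti : Antitone d := slope_antitone hf hδ
  have hd0 : 0 ≤ d N := div_nonneg (sub_nonneg.2 (hmono (by push_cast; nlinarith))) hδ.le
  have e : _root_.interp f δ N = fun t => ∑ j ∈ Finset.range N,
      (d j - d (j + 1)) * min (max t 0) ((j + 1 : ℕ) * δ) + d N * min (max t 0) (N * δ) := by
    funext t
    exact sum_mul_sub_eq d (fun j => min (max t 0) (j * δ)) (by simp) N
  rw [e]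
  refine add (sum N fun j => ?_) ((truncation hA hB hδ hAB hN).const_mul hd0)
  exact (truncation hA hB hδ hAB (Nat.le_add_left 1 j)).const_mul
    (sub_nonneg.2 (hanti (Nat.le_succ j)))

end HasLogBound

end Combination

theorem stmt7 :
    ∃ c : ℝ, 0 < c ∧
      ∀ f : ℝ → ℝ, Continuous f → Monotone f → (∀ t ≤ (0 : ℝ), f t = 0) →
        ConcaveOn ℝ (Set.Ici 0) f →
        Filter.Tendsto (fun t => f t / t) Filter.atTop (nhds 0) →
        ∀ δ : ℝ, 0 < δ →
        ∀ (H : Type) [NormedAddCommGroup H] [InnerProductSpace ℂ H] [CompleteSpace H]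
          (A B : H →L[ℂ] H), IsSelfAdjoint A → IsSelfAdjoint B → ‖A - B‖ ≤ δ →
          (‖cfc f A - cfc f B‖₊ : ℝ≥0∞) ≤
            ENNReal.ofReal c *
              ∫⁻ s in Set.Ioi (Real.exp 1),
                ENNReal.ofReal (f (δ * s) / (s ^ 2 * Real.log s)) := by
  refine ⟨1984, by norm_num, ?_⟩
  intro f hfc hmono hneg hf _ δ hδ H _ _ _ A B hA hB hAB
  change _ ≤ ENNReal.ofReal 1984 * logIntegral δ f
  have hf0 : f 0 = 0 := hneg 0 le_rfl
  have hfδ : 0 ≤ f δ := hf0 ▸ hmono hδ.le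
  obtain ⟨M, hM⟩ := exists_nat_ge (max ‖A‖ ‖B‖ / δ)
  set N := M + 1 with hN
  have hNR : max ‖A‖ ‖B‖ ≤ N * δ := by
    rw [div_le_iff₀ hδ] at hM
    push_cast [hN]
    nlinarith
  obtain ⟨hnear, hfar⟩ := interp_bounds hf hmono hf0 hδ N
  obtain ⟨hgc, -, hg⟩ := HasLogBound.interp hA hB hδ hAB hf hmono (show 1 ≤ N by omega)
  have hclose : ∀ T : H →L[ℂ] H, IsSelfAdjoint T → ‖T‖ ≤ max ‖A‖ ‖B‖ →
      ‖cfc f T - cfc (interp f δ N) T‖ ≤ f δ := by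
    intro T hT hTR
    rw [← cfc_sub f (interp f δ N) T hfc.continuousOn hgc.continuousOn]
    refine norm_cfc_le hfδ fun t ht => ?_
    have htN : t ≤ N * δ :=
      (le_abs_self t).trans ((abs_le_norm_of_mem_spectrum ht).trans (hTR.trans hNR))
    rcases le_total t 0 with h | h
    · simpa [hneg t h, interp_eq_zero N hδ h] using hfδ
    · obtain ⟨h1, h2⟩ := hnear t h htN
      rw [Real.norm_of_nonneg (sub_nonneg.2 h1)]
      linarith
  have hle : logIntegral δ (interp f δ N) ≤ logIntegral δ f := by
    refine logIntegral_mono hδ fun t ht => ?_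
    rcases le_total t (N * δ) with h | h
    · exact (hnear t ht.le h).1
    · rw [hfar t h]
      exact hmono h
  have herr : ENNReal.ofReal (f δ / 32) ≤ logIntegral δ f :=
    le_logIntegral hfδ fun s hs => hmono (by nlinarith)
  have hnorm : ‖cfc f A - cfc f B‖
      ≤ ‖cfc (interp f δ N) A - cfc (interp f δ N) B‖ + 64 * (f δ / 32) := by
    have hA' := hclose A hA (le_max_left _ _)
    have hB' := hclose B hB (le_max_right _ _)
    calc ‖cfc f A - cfc f B‖
        = ‖(cfc f A - cfc (interp f δ N) A) + (cfc (interp f δ N) A - cfc (interp f δ N) B)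
            + -(cfc f B - cfc (interp f δ N) B)‖ := by congr 1; abel
      _ ≤ ‖cfc f A - cfc (interp f δ N) A‖ + ‖cfc (interp f δ N) A - cfc (interp f δ N) B‖
            + ‖cfc f B - cfc (interp f δ N) B‖ := by
          refine norm_add₃_le.trans ?_
          rw [norm_neg]
      _ ≤ _ := by linarith
  calc (‖cfc f A - cfc f B‖₊ : ℝ≥0∞) = ENNReal.ofReal ‖cfc f A - cfc f B‖ :=
        (ofReal_norm _).symm
    _ ≤ ENNReal.ofReal ‖cfc (interp f δ N) A - cfc (interp f δ N) B‖
          + ENNReal.ofReal 64 * ENNReal.ofReal (f δ / 32) := by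
        rw [← ENNReal.ofReal_mul (by norm_num), ← ENNReal.ofReal_add (norm_nonneg _)
          (by positivity)]
        exact ENNReal.ofReal_le_ofReal hnorm
    _ ≤ ENNReal.ofReal 1920 * logIntegral δ f + ENNReal.ofReal 64 * logIntegral δ f := by
        refine add_le_add (hg.trans ?_) ?_ <;> gcongr
    _ = _ := by
        rw [← add_mul, ← ENNReal.ofReal_add (by norm_num) (by norm_num)]
        norm_num
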